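/- Let a, b, c ≥ 0 with a² = b² - c², and let 1 ≤ p ≤ 2 and 0 < ε ≤ 1. If a^p ≥ ε·b^p and b^p ≥ c^p, then a^p ≤ 10·ε^((p-2)/p)·(b^p - c^p). -/

import Mathlib

lemma aux (a c p ε : ℝ) (ha : 0 ≤ a) (hc : 0 ≤ c)
    (habc : a ^ 2 = 1 - c ^ 2) (hp1 : 1 ≤ p) (hp2 : p ≤ 2)
    (hε0 : 0 < ε) (hab : ε ≤ a ^ p) :
    a ^ p ≤ 10 * ε ^ ((p - 2) / p) * (1 - c ^ p) := by
  have ha0 : 0 < a := by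
    rcases ha.eq_or_lt with h | h
    · rw [← h, Real.zero_rpow (by linarith)] at hab
      linarith
    · exact h
  have h1 : c ^ p ≤ 1 + p / 2 * (c ^ 2 - 1) := by
    have h := rpow_one_add_le_one_add_mul_self (s := c ^ 2 - 1) (p := p / 2)
      (by nlinarith [sq_nonneg c]) (by linarith) (by linarith)
    have e : (1 + (c ^ 2 - 1)) ^ (p / 2) = c ^ p := by
      rw [add_sub_cancel, ← Real.rpow_natCast, ← Real.rpow_mul hc]
      congr 1
      push_cast
      ring
    rwa [e] at h
  have h2 : a ^ 2 / 2 ≤ 1 - c ^ p := by nlinarith [sq_nonneg a]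
  have h3 : (a ^ p) ^ ((p - 2) / p) ≤ ε ^ ((p - 2) / p) :=
    Real.rpow_le_rpow_of_nonpos hε0 hab
      (div_nonpos_of_nonpos_of_nonneg (by linarith) (by linarith))
  have h4 : a ^ p = (a ^ p) ^ ((p - 2) / p) * a ^ 2 := by
    rw [← Real.rpow_mul ha, mul_div_cancel₀ _ (by linarith : p ≠ 0), ← Real.rpow_natCast a 2,
      ← Real.rpow_add ha0]
    congr 1
    push_cast
    ring
  have h5 : 0 < ε ^ ((p - 2) / p) := Real.rpow_pos_of_pos hε0 _
  rw [h4]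
  nlinarith [mul_le_mul_of_nonneg_right h3 (sq_nonneg a), mul_le_mul_of_nonneg_left h2 h5.le,
    mul_nonneg h5.le (sq_nonneg a)]

theorem stmt_1 (a b c p ε : ℝ) (ha : 0 ≤ a) (hb : 0 ≤ b) (hc : 0 ≤ c)
    (habc : a ^ 2 = b ^ 2 - c ^ 2) (hp1 : 1 ≤ p) (hp2 : p ≤ 2)
    (hε0 : 0 < ε) (hε1 : ε ≤ 1)
    (hab : ε * b ^ p ≤ a ^ p) (hbc : c ^ p ≤ b ^ p) :
    a ^ p ≤ 10 * ε ^ ((p - 2) / p) * (b ^ p - c ^ p) := by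
  rcases hb.eq_or_lt with h | h
  · have ha0 : a = 0 := by
      subst h
      nlinarith [sq_nonneg a, sq_nonneg c]
    rw [ha0, Real.zero_rpow (by linarith)]
    exact mul_nonneg (mul_nonneg (by norm_num) (Real.rpow_nonneg hε0.le _)) (by linarith)
  · have hB : 0 < b ^ p := Real.rpow_pos_of_pos h _
    have key := aux (a / b) (c / b) p ε (by positivity) (by positivity)
      (by field_simp; linarith) hp1 hp2 hε0
      (by rw [Real.div_rpow ha hb, le_div_iff₀ hB]; exact hab)
    rw [Real.div_rpow ha hb, Real.div_rpow hc hb, div_le_iff₀ hB, mul_assoc, sub_mul, one_mul,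
      div_mul_cancel₀ _ hB.ne'] at key
    exact key
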